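/- For w ∈ W the following are equivalent: (1) there exist distinct i, j ∈ I with M i j finite and w = w₀(i, j); (2) there exist distinct a, b ∈ I such that D_L(w) = D_R(w) = {a, b} and both w s_a and w s_b are bigrassmannian. Moreover, in case (2), M a b is finite and w = w₀(a, b). -/

import Mathlib

open CoxeterSystem

namespace NilpotencyIndices

variable {B : Type*} {W : Type*} [Group W] {M : CoxeterMatrix B}

/-- The set `Γ(W)` of triples `(w, i, j)` with `ℓ(sᵢ w sⱼ) = ℓ(w) - 2`
(stated as `ℓ(sᵢ w sⱼ) + 2 = ℓ(w)` to avoid truncated subtraction). -/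
def InGamma (cs : CoxeterSystem M W) (x : W × B × B) : Prop :=
  cs.length (cs.simple x.2.1 * x.1 * cs.simple x.2.2) + 2 = cs.length x.1

/-- The weak left (Bruhat) order: `v ≤_L w` iff `ℓ(v) + ℓ(w v⁻¹) = ℓ(w)`. -/
def WeakLeftLE (cs : CoxeterSystem M W) (v w : W) : Prop :=
  cs.length v + cs.length (w * v⁻¹) = cs.length w

/-- The weak right (Bruhat) order: `v ≤_R w` iff `ℓ(v) + ℓ(v⁻¹ w) = ℓ(w)`. -/
def WeakRightLE (cs : CoxeterSystem M W) (v w : W) : Prop :=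
  cs.length v + cs.length (v⁻¹ * w) = cs.length w

/-- `v(α_a) = α_b`: the group-theoretic condition `v sₐ v⁻¹ = s_b` and `ℓ(v sₐ) = ℓ(v) + 1`. -/
def MapsSimple (cs : CoxeterSystem M W) (v : W) (a b : B) : Prop :=
  v * cs.simple a * v⁻¹ = cs.simple b ∧ cs.length (v * cs.simple a) = cs.length v + 1

/-- `(w, i, j) →_L (u, i', j')` iff both triples are in `Γ(W)`, `u ≤_L w`, `j' = j`, and
`(w u⁻¹)(α_{i'}) = α_i`. -/
def RedL (cs : CoxeterSystem M W) (x y : W × B × B) : Prop :=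
  InGamma cs x ∧ InGamma cs y ∧ WeakLeftLE cs y.1 x.1 ∧ y.2.2 = x.2.2 ∧
    MapsSimple cs (x.1 * y.1⁻¹) y.2.1 x.2.1

/-- `(w, i, j) →_R (u, i', j')` iff both triples are in `Γ(W)`, `u ≤_R w`, `i' = i`, and
`(u⁻¹ w)(α_j) = α_{j'}`. -/
def RedR (cs : CoxeterSystem M W) (x y : W × B × B) : Prop :=
  InGamma cs x ∧ InGamma cs y ∧ WeakRightLE cs y.1 x.1 ∧ y.2.1 = x.2.1 ∧
    MapsSimple cs (y.1⁻¹ * x.1) x.2.2 y.2.2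

/-- `→`: the reflexive-transitive closure of the union of `→_L` and `→_R`. -/
def Red (cs : CoxeterSystem M W) : (W × B × B) → (W × B × B) → Prop :=
  Relation.ReflTransGen (fun x y => RedL cs x y ∨ RedR cs x y)

/-- `↔`: the equivalence relation generated by `→`. -/
def EquivRed (cs : CoxeterSystem M W) : (W × B × B) → (W × B × B) → Prop :=
  Relation.EqvGen (Red cs)

/-- The alternating word `a, b, a, b, …` with `n` letters, starting with `a`. -/
def altWord (a b : B) : ℕ → List B
  | 0 => []
  | n + 1 => a :: altWord b a n

/-- `w₀(a, b)`: the alternating product `sₐ s_b sₐ ⋯` with `M a b` factors, the longest element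
of the subgroup generated by `sₐ` and `s_b` when `M a b` is finite (i.e. nonzero). -/
def w0 (cs : CoxeterSystem M W) (a b : B) : W :=
  cs.wordProd (altWord a b (M a b))

/-- An element is bigrassmannian if it has exactly one left descent and exactly one
right descent. -/
def Bigrassmannian (cs : CoxeterSystem M W) (w : W) : Prop :=
  (∃! i, cs.IsLeftDescent w i) ∧ (∃! j, cs.IsRightDescent w j)

/-- The support of `w`: the set of indices appearing in some reduced word for `w`. -/
def Supp (cs : CoxeterSystem M W) (w : W) : Set B :=
  {i | ∃ l : List B, cs.IsReduced l ∧ cs.wordProd l = w ∧ i ∈ l}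

/-- The relation `(w, i, j) →_{(k,L)} (u, i', j')`. -/
def RedkL (cs : CoxeterSystem M W) (k : B) (x y : W × B × B) : Prop :=
  cs.length y.1 < cs.length x.1 ∧ RedR cs (x.1 * cs.simple k, x.2.1, x.2.2) x ∧
    RedL cs (x.1 * cs.simple k, x.2.1, x.2.2) y ∧ WeakLeftLE cs y.1 x.1

/-- The relation `(w, i, j) →_{(k,R)} (u, i', j')`. -/
def RedkR (cs : CoxeterSystem M W) (k : B) (x y : W × B × B) : Prop :=
  cs.length y.1 < cs.length x.1 ∧ RedL cs (cs.simple k * x.1, x.2.1, x.2.2) x ∧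
    RedR cs (cs.simple k * x.1, x.2.1, x.2.2) y ∧ WeakRightLE cs y.1 x.1

/-- The orthogonality condition for a bigrassmannian element `w` with `D_L(w) = {i}` and
`D_R(w) = {j}`. -/
def OrthCond (cs : CoxeterSystem M W) (w : W) (i j : B) : Prop :=
  (∀ a b : B, M a j = 2 → MapsSimple cs w a b → M b i = 2) ∧
  (∀ a b : B, M a i = 2 → MapsSimple cs w⁻¹ a b → M b j = 2)


section ReflectionPair

open Module

variable {E : Type*} [AddCommGroup E] [Module ℝ E] {f g : Dual ℝ E} {x y : E}

lemma reflection_mul_reflection_pow_apply_of_recurrence (hf : f x = 2) (hg : g y = 2) {c : ℝ}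
    (hfy : f y = -(2 * c)) (hgx : g x = -(2 * c)) {S : ℕ → ℝ} (h₀ : S 0 = 0) (h₁ : S 1 = 1)
    (hS : ∀ n, S (n + 2) = 2 * c * S (n + 1) - S n) (k : ℕ) :
    ((reflection hf * reflection hg) ^ k) x = S (2 * k + 1) • x + S (2 * k) • y := by
  induction k with
  | zero => simp [h₀, h₁]
  | succ k ih =>
    have e : S (2 * (k + 1) + 1) = 2 * c * S (2 * (k + 1)) - S (2 * k + 1) := hS (2 * k + 1)
    have e' : S (2 * (k + 1)) = 2 * c * S (2 * k + 1) - S (2 * k) := hS (2 * k)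
    rw [pow_succ', LinearEquiv.mul_apply, ih, LinearEquiv.mul_apply]
    simp only [reflection_apply, map_add, map_sub, map_smul, hf, hg, hfy, hgx, e, e']
    module

lemma sin_mul_div_sin_add_two {θ : ℝ} (n : ℕ) :
    Real.sin ((n + 2 : ℕ) * θ) / Real.sin θ =
      2 * Real.cos θ * (Real.sin ((n + 1 : ℕ) * θ) / Real.sin θ) -
        Real.sin (n * θ) / Real.sin θ := by
  have h : Real.sin ((n + 2 : ℕ) * θ) =
      2 * Real.cos θ * Real.sin ((n + 1 : ℕ) * θ) - Real.sin (n * θ) := by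
    have e₁ : ((n + 2 : ℕ) : ℝ) * θ = (n + 1 : ℕ) * θ + θ := by push_cast; ring
    have e₂ : (n : ℝ) * θ = (n + 1 : ℕ) * θ - θ := by push_cast; ring
    rw [e₁, e₂, Real.sin_add, Real.sin_sub]
    ring
  rw [h]
  ring

lemma reflection_mul_reflection_pow_apply_sin (hf : f x = 2) (hg : g y = 2) {θ : ℝ}
    (hθ : Real.sin θ ≠ 0) (hfy : f y = -(2 * Real.cos θ)) (hgx : g x = -(2 * Real.cos θ)) (k : ℕ) :
    ((reflection hf * reflection hg) ^ k) x =
      (Real.sin ((2 * k + 1 : ℕ) * θ) / Real.sin θ) • x +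
        (Real.sin ((2 * k : ℕ) * θ) / Real.sin θ) • y :=
  reflection_mul_reflection_pow_apply_of_recurrence hf hg hfy hgx
    (S := fun n ↦ Real.sin (n * θ) / Real.sin θ) (by simp) (by simp [hθ])
    sin_mul_div_sin_add_two k

lemma sin_pi_div_ne_zero {m : ℕ} (hm : 2 ≤ m) : Real.sin (Real.pi / m) ≠ 0 := by
  have hm' : (2 : ℝ) ≤ m := by exact_mod_cast hm
  refine (Real.sin_pos_of_pos_of_lt_pi (by positivity) ?_).ne'
  rw [div_lt_iff₀ (by linarith)]
  nlinarith [Real.pi_pos]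

lemma reflection_mul_reflection_pow_apply_left (hf : f x = 2) (hg : g y = 2) {m : ℕ} (hm : 2 ≤ m)
    (hfy : f y = -(2 * Real.cos (Real.pi / m))) (hgx : g x = -(2 * Real.cos (Real.pi / m))) :
    ((reflection hf * reflection hg) ^ m) x = x := by
  have hs := sin_pi_div_ne_zero hm
  have hm' : (m : ℝ) ≠ 0 := by positivity
  rw [reflection_mul_reflection_pow_apply_sin hf hg hs hfy hgx]
  have e₁ : ((2 * m + 1 : ℕ) : ℝ) * (Real.pi / m) = Real.pi / m + 2 * Real.pi := by
    push_cast; field_simp; ring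
  have e₂ : ((2 * m : ℕ) : ℝ) * (Real.pi / m) = 2 * Real.pi := by push_cast; field_simp
  rw [e₁, e₂, Real.sin_add_two_pi, Real.sin_two_pi, div_self hs]
  simp

lemma reflection_mul_reflection_pow_eq_one (hf : f x = 2) (hg : g y = 2) {m : ℕ} (hm : 2 ≤ m)
    (hfy : f y = -(2 * Real.cos (Real.pi / m))) (hgx : g x = -(2 * Real.cos (Real.pi / m))) :
    (reflection hf * reflection hg) ^ m = 1 := by
  have hx := reflection_mul_reflection_pow_apply_left hf hg hm hfy hgx
  have hy : ((reflection hf * reflection hg) ^ m) y = y := by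
    have h := reflection_mul_reflection_pow_apply_left hg hf hm hgx hfy
    have e : (reflection hg * reflection hf) ^ m = ((reflection hf * reflection hg) ^ m)⁻¹ := by
      rw [← inv_pow, mul_inv_rev, reflection_inv, reflection_inv]
    rw [e] at h
    calc ((reflection hf * reflection hg) ^ m) y
        = ((reflection hf * reflection hg) ^ m) (((reflection hf * reflection hg) ^ m)⁻¹ y) := by
          rw [h]
      _ = y := by rw [← LinearEquiv.mul_apply, mul_inv_cancel, LinearEquiv.coe_one, id]
  have hs := sin_pi_div_ne_zero hm
  set c := Real.cos (Real.pi / m) with hc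
  have hc' : 1 - c ^ 2 ≠ 0 := by
    have := Real.sin_sq_add_cos_sq (Real.pi / m)
    rw [← hc] at this
    rw [← this]
    simpa using hs
  ext z
  obtain ⟨α, β, z₀, hz, hfz, hgz⟩ :
      ∃ (α β : ℝ) (z₀ : E), z = z₀ + α • x + β • y ∧ f z₀ = 0 ∧ g z₀ = 0 := by
    refine ⟨(f z + c * g z) / (2 * (1 - c ^ 2)), (c * f z + g z) / (2 * (1 - c ^ 2)),
      z - ((f z + c * g z) / (2 * (1 - c ^ 2))) • x - ((c * f z + g z) / (2 * (1 - c ^ 2))) • y,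
      by module, ?_, ?_⟩
    · simp only [map_sub, map_smul, hf, hfy, smul_eq_mul]
      field_simp
      ring
    · simp only [map_sub, map_smul, hg, hgx, smul_eq_mul]
      field_simp
      ring
  have hz₀ : ∀ k : ℕ, ((reflection hf * reflection hg) ^ k) z₀ = z₀ := by
    intro k
    induction k with
    | zero => simp
    | succ k ih => simp [pow_succ', LinearEquiv.mul_apply, ih, reflection_apply, hfz, hgz]
  simp [hz, hx, hy, hz₀]

end ReflectionPair

section GeometricRepresentation

open Module

variable (M) in
/-- The functional `v ↦ 2 ⟨v, α_i⟩` on the space spanned by the simple roots. -/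
noncomputable def simpleCoroot (i : B) : Dual ℝ (B →₀ ℝ) :=
  Finsupp.lift ℝ ℝ B fun j ↦ -(2 * Real.cos (Real.pi / M i j))

lemma simpleCoroot_single (i j : B) :
    simpleCoroot M i (Finsupp.single j 1) = -(2 * Real.cos (Real.pi / M i j)) := by
  simp [simpleCoroot]

lemma simpleCoroot_single_self (i : B) : simpleCoroot M i (Finsupp.single i 1) = 2 := by
  simp [simpleCoroot_single]

variable (M) in
/-- The action of a simple reflection in the geometric representation. -/
noncomputable def geometricReflection (i : B) : (B →₀ ℝ) ≃ₗ[ℝ] (B →₀ ℝ) :=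
  reflection (simpleCoroot_single_self (M := M) i)

lemma two_le_of_ne {i j : B} (hij : i ≠ j) (h : M i j ≠ 0) : 2 ≤ M i j := by
  have := M.off_diagonal i j hij
  change M i j ≠ 1 at this
  omega

variable (M) in
lemma isLiftable_geometricReflection : M.IsLiftable (geometricReflection M) := by
  intro i j
  by_cases hij : i = j
  · subst hij
    rw [M.diagonal, pow_one, geometricReflection]
    nth_rw 1 [← reflection_inv]
    exact inv_mul_cancel _
  by_cases h : M i j = 0
  · rw [h, pow_zero]
  · exact reflection_mul_reflection_pow_eq_one _ _ (two_le_of_ne hij h) (simpleCoroot_single i j)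
      (by rw [simpleCoroot_single, M.symmetric])

lemma geometricReflection_pow_ne_one {i j : B} (hij : i ≠ j) {k : ℕ} (hk : 0 < k)
    (hkm : M i j = 0 ∨ k < M i j) :
    (geometricReflection M i * geometricReflection M j) ^ k ≠ 1 := by
  intro h
  have hfy := simpleCoroot_single (M := M) i j
  have hgx : simpleCoroot M j (Finsupp.single i 1) = -(2 * Real.cos (Real.pi / M i j)) := by
    rw [simpleCoroot_single, M.symmetric]
  have key : ∀ p q : ℝ, ((geometricReflection M i * geometricReflection M j) ^ k)
      (Finsupp.single i 1) = p • Finsupp.single i 1 + q • Finsupp.single j 1 → p = 1 ∧ q = 0 := by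
    intro p q hpq
    rw [h, LinearEquiv.coe_one, id] at hpq
    have h₁ := DFunLike.congr_fun hpq i
    have h₂ := DFunLike.congr_fun hpq j
    simp [hij, hij.symm] at h₁ h₂
    exact ⟨h₁.symm, h₂.symm⟩
  by_cases hm : M i j = 0
  · have := key _ _ (reflection_mul_reflection_pow_apply_of_recurrence _ _ hfy hgx
      (S := fun n ↦ (n : ℝ)) (by simp) (by simp) (by intro n; simp [hm]; ring) k)
    have h2 := this.2
    simp at h2
    omega
  · have hm2 := two_le_of_ne hij hm
    have hs := sin_pi_div_ne_zero hm2
    have hkm' : k < M i j := by tauto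
    obtain ⟨h₁, h₂⟩ := key _ _ (reflection_mul_reflection_pow_apply_sin _ _ hs hfy hgx k)
    generalize M i j = m at *
    have hm' : (m : ℝ) ≠ 0 := by exact_mod_cast hm
    rw [div_eq_zero_iff, or_iff_left hs, Real.sin_eq_zero_iff] at h₂
    obtain ⟨n, hn⟩ := h₂
    have hn' : n * (m : ℤ) = 2 * k := by
      have : (n : ℝ) * m = 2 * k := by
        push_cast at hn
        field_simp at hn
        exact hn
      exact_mod_cast this
    have hn1 : n = 1 := by
      have : 0 < n := by
        by_contra! hn0
        nlinarith
      have : n < 2 := by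
        by_contra! hn0
        nlinarith
      omega
    have e : ((2 * k + 1 : ℕ) : ℝ) * (Real.pi / m) = Real.pi / m + Real.pi := by
      have : (m : ℝ) = 2 * k := by rw [hn1, one_mul] at hn'; exact_mod_cast hn'
      push_cast
      rw [← this]
      field_simp
      ring
    rw [e, Real.sin_add_pi, neg_div, div_self hs] at h₁
    norm_num at h₁

lemma simple_mul_simple_pow_ne_one (cs : CoxeterSystem M W) {i j : B} (hij : i ≠ j) {k : ℕ}
    (hk : 0 < k) (hkm : M i j = 0 ∨ k < M i j) : (cs.simple i * cs.simple j) ^ k ≠ 1 := by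
  intro h
  apply geometricReflection_pow_ne_one hij hk hkm
  have := congrArg (cs.lift ⟨_, isLiftable_geometricReflection M⟩) h
  simpa only [map_pow, map_mul, map_one, cs.lift_apply_simple] using this

lemma simple_injective (cs : CoxeterSystem M W) : Function.Injective cs.simple := by
  intro i j h
  by_contra hij
  refine simple_mul_simple_pow_ne_one cs hij one_pos ?_ (by rw [h]; simp)
  by_cases h0 : M i j = 0
  · exact .inl h0
  · exact .inr (two_le_of_ne hij h0)

end GeometricRepresentation

section InversionParity

lemma end_one_apply {α : Type*} (x : α) : (1 : Function.End α) x = x := rfl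

lemma end_mul_apply {α : Type*} (f g : Function.End α) (x : α) : (f * g) x = f (g x) := rfl

open Classical in
/-- The action of a simple reflection on pairs of a group element and a sign, which conjugates
the first component and changes the sign exactly when that component is the reflection itself. -/
noncomputable def signedConj (cs : CoxeterSystem M W) (i : B) : Function.End (W × ZMod 2) :=
  fun p ↦ (cs.simple i * p.1 * cs.simple i, p.2 + if p.1 = cs.simple i then 1 else 0)

open Classical in
lemma signedConj_mul_pow_apply (cs : CoxeterSystem M W) (i j : B) (k : ℕ) (t : W) (ε : ZMod 2) :
    ((signedConj cs i * signedConj cs j) ^ k) (t, ε) =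
      ((cs.simple i * cs.simple j) ^ k * t * ((cs.simple i * cs.simple j) ^ k)⁻¹,
        ε + ∑ n ∈ Finset.range (2 * k),
          if t = (cs.simple j * cs.simple i) ^ n * cs.simple j then 1 else 0) := by
  induction k with
  | zero => simp [end_one_apply]
  | succ k ih =>
    have hinv : ((cs.simple i * cs.simple j) ^ k)⁻¹ = (cs.simple j * cs.simple i) ^ k := by
      rw [← inv_pow, mul_inv_rev, cs.inv_simple, cs.inv_simple]
    have hswap : (cs.simple j * cs.simple i) ^ k * cs.simple j =
        cs.simple j * (cs.simple i * cs.simple j) ^ k := mul_pow_mul _ _ _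
    have h₁ : (cs.simple i * cs.simple j) ^ k * t * ((cs.simple i * cs.simple j) ^ k)⁻¹ =
        cs.simple j ↔ t = (cs.simple j * cs.simple i) ^ (2 * k) * cs.simple j := by
      rw [two_mul, pow_add, mul_assoc _ _ (cs.simple j), hswap, mul_inv_eq_iff_eq_mul,
        ← eq_inv_mul_iff_mul_eq, hinv]
    have h₂ : cs.simple j * ((cs.simple i * cs.simple j) ^ k * t *
        ((cs.simple i * cs.simple j) ^ k)⁻¹) * cs.simple j = cs.simple i ↔
          t = (cs.simple j * cs.simple i) ^ (2 * k + 1) * cs.simple j := by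
      have e : (cs.simple j * cs.simple i) ^ (2 * k + 1) * cs.simple j =
          (cs.simple j * cs.simple i) ^ k *
            (cs.simple j * cs.simple i * cs.simple j * (cs.simple i * cs.simple j) ^ k) := by
        rw [show 2 * k + 1 = k + 1 + k by ring, pow_add, mul_assoc, hswap, pow_succ]
        simp only [mul_assoc]
      rw [e, ← hinv, eq_inv_mul_iff_mul_eq, ← mul_inv_eq_iff_eq_mul]
      generalize (cs.simple i * cs.simple j) ^ k * t * ((cs.simple i * cs.simple j) ^ k)⁻¹ = r
      constructor
      · intro h
        simp [← h, mul_assoc]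
      · rintro rfl
        simp [mul_assoc]
    rw [pow_succ', end_mul_apply, ih, end_mul_apply]
    refine Prod.ext ?_ ?_
    · simp only [signedConj, pow_succ', mul_inv_rev, cs.inv_simple, mul_assoc]
    · simp only [signedConj, h₁, h₂]
      rw [show 2 * (k + 1) = 2 * k + 1 + 1 by ring, Finset.sum_range_succ, Finset.sum_range_succ]
      ring

lemma isLiftable_signedConj (cs : CoxeterSystem M W) : M.IsLiftable (signedConj cs) := by
  classical
  intro i j
  funext ⟨t, ε⟩
  rw [signedConj_mul_pow_apply, cs.simple_mul_simple_pow, two_mul, Finset.sum_range_add]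
  simp only [pow_add, cs.simple_mul_simple_pow', one_mul]
  rw [CharTwo.add_self_eq_zero]
  simp [end_one_apply]

/-- The number modulo two of the occurrences of `t` in the right inversion sequence of any word
for `w`. -/
noncomputable def inversionParity (cs : CoxeterSystem M W) (w t : W) : ZMod 2 :=
  (cs.lift ⟨signedConj cs, isLiftable_signedConj cs⟩ w (t, 0)).2

open Classical in
lemma lift_signedConj_wordProd (cs : CoxeterSystem M W) (ω : List B) (t : W) (ε : ZMod 2) :
    cs.lift ⟨signedConj cs, isLiftable_signedConj cs⟩ (cs.wordProd ω) (t, ε) =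
      (cs.wordProd ω * t * (cs.wordProd ω)⁻¹, ε + (cs.rightInvSeq ω).count t) := by
  induction ω with
  | nil => simp [end_one_apply]
  | cons i ω ih =>
    rw [cs.wordProd_cons, map_mul, cs.lift_apply_simple, end_mul_apply, ih]
    have h : cs.wordProd ω * t * (cs.wordProd ω)⁻¹ = cs.simple i ↔
        (cs.wordProd ω)⁻¹ * cs.simple i * cs.wordProd ω = t := by
      rw [mul_inv_eq_iff_eq_mul, ← eq_inv_mul_iff_mul_eq, mul_assoc, eq_comm]
    refine Prod.ext ?_ ?_
    · simp [signedConj, mul_assoc]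
    · simp only [signedConj, h, rightInvSeq, List.count_cons, beq_iff_eq]
      push_cast
      ring

open Classical in
lemma inversionParity_wordProd (cs : CoxeterSystem M W) (ω : List B) (t : W) :
    inversionParity cs (cs.wordProd ω) t = (cs.rightInvSeq ω).count t := by
  simp [inversionParity, lift_signedConj_wordProd]

lemma inversionParity_mul (cs : CoxeterSystem M W) (u v t : W) :
    inversionParity cs (u * v) t =
      inversionParity cs v t + inversionParity cs u (v * t * v⁻¹) := by
  classical
  obtain ⟨ω, rfl⟩ := cs.wordProd_surjective u
  obtain ⟨ω', rfl⟩ := cs.wordProd_surjective v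
  rw [inversionParity, map_mul, end_mul_apply,
    lift_signedConj_wordProd, lift_signedConj_wordProd, inversionParity_wordProd,
    inversionParity_wordProd, zero_add]

lemma inversionParity_eq_zero_or_one (cs : CoxeterSystem M W) (w t : W) :
    inversionParity cs w t = 0 ∨ inversionParity cs w t = 1 := by
  generalize inversionParity cs w t = n
  revert n
  decide

lemma inversionParity_simple_self (cs : CoxeterSystem M W) (i : B) :
    inversionParity cs (cs.simple i) (cs.simple i) = 1 := by
  classical
  rw [← cs.wordProd_singleton, inversionParity_wordProd]
  simp

lemma eq_of_inversionParity_simple (cs : CoxeterSystem M W) {i : B} {t : W}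
    (h : inversionParity cs (cs.simple i) t = 1) : t = cs.simple i := by
  classical
  by_contra hne
  rw [← cs.wordProd_singleton, inversionParity_wordProd] at h
  simp [Ne.symm hne] at h

lemma mem_rightInvSeq_of_inversionParity (cs : CoxeterSystem M W) {ω : List B} {t : W}
    (h : inversionParity cs (cs.wordProd ω) t = 1) : t ∈ cs.rightInvSeq ω := by
  classical
  by_contra hne
  rw [inversionParity_wordProd, List.count_eq_zero_of_not_mem hne] at h
  simp at h

lemma inversionParity_eq_one_of_nodup (cs : CoxeterSystem M W) {ω : List B} {t : W}
    (hω : (cs.rightInvSeq ω).Nodup) (h : t ∈ cs.rightInvSeq ω) :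
    inversionParity cs (cs.wordProd ω) t = 1 := by
  classical
  rw [inversionParity_wordProd, List.count_eq_one_of_mem hω h, Nat.cast_one]

lemma isReduced_of_nodup_rightInvSeq (cs : CoxeterSystem M W) {ω : List B}
    (hω : (cs.rightInvSeq ω).Nodup) : cs.IsReduced ω := by
  classical
  obtain ⟨ω', hω', h⟩ := cs.exists_isReduced (cs.wordProd ω)
  have hsub : cs.rightInvSeq ω ⊆ cs.rightInvSeq ω' := fun t ht ↦
    mem_rightInvSeq_of_inversionParity cs (h ▸ inversionParity_eq_one_of_nodup cs hω ht)
  have hle := (hω.subperm hsub).length_le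
  rw [cs.length_rightInvSeq, cs.length_rightInvSeq, ← hω'.eq, ← h] at hle
  exact le_antisymm (cs.length_wordProd_le ω) hle

lemma length_mul_lt_of_inversionParity (cs : CoxeterSystem M W) {w t : W}
    (h : inversionParity cs w t = 1) : cs.length (w * t) < cs.length w := by
  obtain ⟨ω, hω, rfl⟩ := cs.exists_isReduced w
  exact (cs.isRightInversion_of_mem_rightInvSeq hω
    (mem_rightInvSeq_of_inversionParity cs h)).2

lemma isRightDescent_iff_inversionParity (cs : CoxeterSystem M W) {w : W} {i : B} :
    cs.IsRightDescent w i ↔ inversionParity cs w (cs.simple i) = 1 := by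
  refine ⟨fun h ↦ ?_, length_mul_lt_of_inversionParity cs⟩
  have h' : ¬ cs.IsRightDescent (w * cs.simple i) i :=
    (cs.isRightDescent_iff_not_isRightDescent_mul).1 h
  have h0 : inversionParity cs (w * cs.simple i) (cs.simple i) = 0 :=
    (inversionParity_eq_zero_or_one cs _ _).resolve_right
      fun h1 ↦ h' (length_mul_lt_of_inversionParity cs h1)
  have := inversionParity_mul cs (w * cs.simple i) (cs.simple i) (cs.simple i)
  rw [cs.simple_mul_simple_cancel_right, inversionParity_simple_self, mul_inv_cancel_right, h0,
    add_zero] at this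
  exact this

/-- If multiplying `w` on the right by `s_j` destroys the left descent `i`, then `s_i w = w s_j`. -/
lemma simple_mul_eq_mul_simple (cs : CoxeterSystem M W) {w : W} {i j : B}
    (hi : cs.IsLeftDescent w i) (hj : cs.IsRightDescent w j)
    (hij : ¬ cs.IsLeftDescent (w * cs.simple j) i) : cs.simple i * w = w * cs.simple j := by
  rw [cs.isLeftDescent_iff] at hi
  rw [cs.not_isLeftDescent_iff] at hij
  have hj0 : inversionParity cs w (cs.simple j) = 1 :=
    (isRightDescent_iff_inversionParity cs).1 hj
  rw [cs.isRightDescent_iff] at hj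
  have hd : ¬ cs.IsRightDescent (cs.simple i * w) j := by
    rw [IsRightDescent, mul_assoc]
    omega
  rw [isRightDescent_iff_inversionParity, inversionParity_mul, hj0] at hd
  have h1 : inversionParity cs (cs.simple i) (w * cs.simple j * w⁻¹) = 1 := by
    refine (inversionParity_eq_zero_or_one cs _ _).resolve_left fun h0 ↦ hd ?_
    rw [h0, add_zero]
  rw [← eq_of_inversionParity_simple cs h1, inv_mul_cancel_right]

end InversionParity

section RankTwo

lemma rightInvSeq_alternatingWord (cs : CoxeterSystem M W) (i j : B) (n : ℕ) :
    cs.rightInvSeq (alternatingWord i j n) =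
      ((List.range n).map fun k ↦ (cs.simple j * cs.simple i) ^ k * cs.simple j).reverse := by
  induction n generalizing i j with
  | zero => simp [alternatingWord]
  | succ n ih =>
    rw [alternatingWord_succ, rightInvSeq_concat, ih, List.range_succ_eq_map, List.map_cons,
      List.reverse_cons, List.map_map, List.map_reverse, List.map_map, List.concat_eq_append]
    simp only [pow_zero, one_mul]
    congr 3
    funext k
    simp only [Function.comp_apply, MulAut.conj_apply, cs.inv_simple, pow_succ, Nat.succ_eq_add_one]
    rw [← mul_assoc, ← mul_assoc, ← mul_pow_mul]

lemma isReduced_alternatingWord (cs : CoxeterSystem M W) {i j : B} (hij : i ≠ j) {n : ℕ}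
    (hn : M i j = 0 ∨ n ≤ M i j) : cs.IsReduced (alternatingWord i j n) := by
  apply isReduced_of_nodup_rightInvSeq
  rw [rightInvSeq_alternatingWord, List.nodup_reverse]
  refine List.Nodup.map_on ?_ List.nodup_range
  have key : ∀ k l, k < l → l < n →
      (cs.simple j * cs.simple i) ^ k ≠ (cs.simple j * cs.simple i) ^ l := by
    intro k l hkl hl h
    refine simple_mul_simple_pow_ne_one cs hij.symm (Nat.sub_pos_of_lt hkl)
      (by rw [M.symmetric]; omega) ?_
    rwa [← Nat.add_sub_cancel' hkl.le, pow_add, eq_comm, mul_eq_left] at h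
  intro k hk l hl h
  rw [List.mem_range] at hk hl
  have h' := mul_right_cancel h
  rcases lt_trichotomy k l with hkl | hkl | hkl
  · exact absurd h' (key k l hkl hl)
  · exact hkl
  · exact absurd h'.symm (key l k hkl hk)

lemma length_alternatingWord_prod (cs : CoxeterSystem M W) {i j : B} (hij : i ≠ j) {n : ℕ}
    (hn : M i j = 0 ∨ n ≤ M i j) : cs.length (cs.wordProd (alternatingWord i j n)) = n := by
  rw [(isReduced_alternatingWord cs hij hn).eq, length_alternatingWord]

lemma wordProd_alternatingWord_succ (cs : CoxeterSystem M W) (i j : B) (n : ℕ) :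
    cs.wordProd (alternatingWord i j (n + 1)) =
      cs.wordProd (alternatingWord j i n) * cs.simple j := by
  rw [alternatingWord_succ, cs.wordProd_concat]

lemma wordProd_alternatingWord_swap (cs : CoxeterSystem M W) (i j : B) :
    cs.wordProd (alternatingWord i j (M i j)) = cs.wordProd (alternatingWord j i (M i j)) := by
  simpa only [braidWord, M.symmetric j i] using cs.wordProd_braidWord_eq i j

lemma altWord_eq_alternatingWord (i j : B) (n : ℕ) :
    altWord i j n = if Even n then alternatingWord i j n else alternatingWord j i n := by
  induction n generalizing i j with
  | zero => simp [altWord, alternatingWord]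
  | succ n ih =>
    rw [altWord, ih, alternatingWord_succ', alternatingWord_succ']
    by_cases h : Even n <;> simp [h, Nat.even_add_one]

lemma reverse_alternatingWord (i j : B) (n : ℕ) :
    (alternatingWord i j n).reverse = altWord j i n := by
  induction n generalizing i j with
  | zero => simp [altWord, alternatingWord]
  | succ n ih => rw [alternatingWord_succ, altWord, List.concat_eq_append,
    List.reverse_append, ih, List.reverse_singleton, List.singleton_append]

lemma inv_wordProd_alternatingWord (cs : CoxeterSystem M W) (i j : B) (n : ℕ) :
    (cs.wordProd (alternatingWord i j n))⁻¹ = cs.wordProd (alternatingWord i j n) ∨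
      (cs.wordProd (alternatingWord i j n))⁻¹ = cs.wordProd (alternatingWord j i n) := by
  rw [← cs.wordProd_reverse, reverse_alternatingWord, altWord_eq_alternatingWord]
  split_ifs
  exacts [.inr rfl, .inl rfl]

lemma w0_eq_wordProd_alternatingWord (cs : CoxeterSystem M W) (i j : B) :
    w0 cs i j = cs.wordProd (alternatingWord i j (M i j)) := by
  rw [w0, altWord_eq_alternatingWord]
  split_ifs
  exacts [rfl, (wordProd_alternatingWord_swap cs i j).symm]

lemma isRightDescent_wordProd_alternatingWord (cs : CoxeterSystem M W) {i j : B} (hij : i ≠ j)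
    {n : ℕ} (h₀ : n ≠ 0) (hn : M i j = 0 ∨ n ≤ M i j) :
    cs.IsRightDescent (cs.wordProd (alternatingWord i j n)) j := by
  obtain ⟨n, rfl⟩ := Nat.exists_eq_succ_of_ne_zero h₀
  rw [IsRightDescent, length_alternatingWord_prod cs hij hn, Nat.succ_eq_add_one,
    wordProd_alternatingWord_succ, cs.simple_mul_simple_cancel_right,
    length_alternatingWord_prod cs hij.symm (by rw [M.symmetric]; omega)]
  exact n.lt_succ_self

lemma not_isRightDescent_wordProd_alternatingWord (cs : CoxeterSystem M W) {i j : B} (hij : i ≠ j)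
    {n : ℕ} (hn : M i j = 0 ∨ n < M i j) :
    ¬ cs.IsRightDescent (cs.wordProd (alternatingWord i j n)) i := by
  rw [IsRightDescent, ← wordProd_alternatingWord_succ,
    length_alternatingWord_prod cs hij (by omega),
    length_alternatingWord_prod cs hij.symm (by rw [M.symmetric]; omega)]
  omega

/-- The standard parabolic subgroup generated by two simple reflections. -/
def rankTwoParabolic (cs : CoxeterSystem M W) (i j : B) : Subgroup W :=
  Subgroup.closure {cs.simple i, cs.simple j}

lemma simple_left_mem_rankTwoParabolic (cs : CoxeterSystem M W) (i j : B) :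
    cs.simple i ∈ rankTwoParabolic cs i j :=
  Subgroup.subset_closure (by simp)

lemma simple_right_mem_rankTwoParabolic (cs : CoxeterSystem M W) (i j : B) :
    cs.simple j ∈ rankTwoParabolic cs i j :=
  Subgroup.subset_closure (by simp)

lemma wordProd_alternatingWord_mem (cs : CoxeterSystem M W) (i j : B) (n : ℕ) :
    cs.wordProd (alternatingWord i j n) ∈ rankTwoParabolic cs i j := by
  rw [cs.prod_alternatingWord_eq_mul_pow]
  refine mul_mem ?_ (pow_mem (mul_mem (simple_left_mem_rankTwoParabolic cs i j)
    (simple_right_mem_rankTwoParabolic cs i j)) _)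
  split_ifs
  exacts [one_mem _, simple_right_mem_rankTwoParabolic cs i j]

lemma rankTwoParabolic_induction_right (cs : CoxeterSystem M W) {i j : B} {p : W → Prop}
    (one : p 1) (mul : ∀ u k, (k = i ∨ k = j) → p u → p (u * cs.simple k)) {u : W}
    (hu : u ∈ rankTwoParabolic cs i j) : p u := by
  induction hu using Subgroup.closure_induction_right with
  | one => exact one
  | mul_right x _ y hy ih =>
    obtain rfl | rfl := hy
    exacts [mul x i (.inl rfl) ih, mul x j (.inr rfl) ih]
  | mul_inv_cancel x _ y hy ih =>
    obtain rfl | rfl := hy <;> rw [cs.inv_simple]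
    exacts [mul x i (.inl rfl) ih, mul x j (.inr rfl) ih]

lemma mem_rankTwoParabolic_of_inversionParity (cs : CoxeterSystem M W) {i j : B} {u : W}
    (hu : u ∈ rankTwoParabolic cs i j) :
    ∀ t, inversionParity cs u t = 1 → t ∈ rankTwoParabolic cs i j := by
  refine rankTwoParabolic_induction_right cs
    (p := fun u ↦ ∀ t, inversionParity cs u t = 1 → t ∈ rankTwoParabolic cs i j)
    (fun t ht ↦ ?_) (fun u k hk ih t ht ↦ ?_) hu
  · have := mem_rightInvSeq_of_inversionParity cs (ω := []) (t := t) (by simpa using ht)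
    simp at this
  · have hk' : cs.simple k ∈ rankTwoParabolic cs i j := by
      obtain rfl | rfl := hk
      exacts [simple_left_mem_rankTwoParabolic cs _ _, simple_right_mem_rankTwoParabolic cs _ _]
    rw [inversionParity_mul] at ht
    obtain h | h := inversionParity_eq_zero_or_one cs (cs.simple k) t
    · rw [h, zero_add] at ht
      have := ih _ ht
      rwa [Subgroup.mul_mem_cancel_right _ (inv_mem hk'), Subgroup.mul_mem_cancel_left _ hk']
        at this
    · rw [eq_of_inversionParity_simple cs h]
      exact hk'

lemma exists_alternatingWord_of_mem_rankTwoParabolic (cs : CoxeterSystem M W) {i j : B}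
    (hij : i ≠ j) {u : W} (hu : u ∈ rankTwoParabolic cs i j) :
    ∃ n, (M i j = 0 ∨ n ≤ M i j) ∧ (u = cs.wordProd (alternatingWord i j n) ∨
      u = cs.wordProd (alternatingWord j i n)) := by
  have step : ∀ (a b : B) (n : ℕ), a ≠ b → (M a b = 0 ∨ n ≤ M a b) → ∀ k, (k = a ∨ k = b) →
      ∃ n', (M a b = 0 ∨ n' ≤ M a b) ∧
        (cs.wordProd (alternatingWord a b n) * cs.simple k = cs.wordProd (alternatingWord a b n') ∨
          cs.wordProd (alternatingWord a b n) * cs.simple k =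
            cs.wordProd (alternatingWord b a n')) := by
    rintro a b n hab hn k (rfl | rfl)
    · rw [← wordProd_alternatingWord_succ]
      by_cases h : M k b = 0 ∨ n + 1 ≤ M k b
      · exact ⟨n + 1, h, .inr rfl⟩
      · have hn' : n = M k b := by omega
        refine ⟨M k b - 1, by omega, .inl ?_⟩
        rw [cs.prod_alternatingWord_eq_prod_alternatingWord_sub _ _ _ (by rw [M.symmetric]; omega),
          M.symmetric b k]
        congr 2
        omega
    · cases n with
      | zero =>
        have := fun h ↦ two_le_of_ne (M := M) hab h
        exact ⟨1, by omega, .inl (by simp [alternatingWord])⟩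
      | succ n =>
        exact ⟨n, by omega, .inr (by
          rw [wordProd_alternatingWord_succ, cs.simple_mul_simple_cancel_right])⟩
  refine rankTwoParabolic_induction_right cs
    (p := fun u ↦ ∃ n, (M i j = 0 ∨ n ≤ M i j) ∧ (u = cs.wordProd (alternatingWord i j n) ∨
      u = cs.wordProd (alternatingWord j i n)))
    ⟨0, by omega, .inl (by simp [alternatingWord])⟩ ?_ hu
  rintro _ k hk ⟨n, hn, rfl | rfl⟩
  · exact step i j n hij hn k hk
  · rw [M.symmetric i j] at hn ⊢
    simpa only [or_comm] using step j i n hij.symm hn k hk.symm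

lemma eq_or_eq_of_simple_mem_rankTwoParabolic (cs : CoxeterSystem M W) {i j k : B} (hij : i ≠ j)
    (hk : cs.simple k ∈ rankTwoParabolic cs i j) : k = i ∨ k = j := by
  obtain ⟨n, hn, h⟩ := exists_alternatingWord_of_mem_rankTwoParabolic cs hij hk
  have h1 : n = 1 := by
    have hl := cs.length_simple k
    obtain h | h := h <;> rw [h] at hl
    · rwa [length_alternatingWord_prod cs hij hn] at hl
    · rwa [length_alternatingWord_prod cs hij.symm (by rwa [M.symmetric])] at hl
  subst h1
  obtain h | h := h
  · exact .inr (simple_injective cs (by simpa [alternatingWord] using h))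
  · exact .inl (simple_injective cs (by simpa [alternatingWord] using h))

lemma eq_or_eq_of_isRightDescent (cs : CoxeterSystem M W) {i j k : B} (hij : i ≠ j) {u : W}
    (hu : u ∈ rankTwoParabolic cs i j) (hk : cs.IsRightDescent u k) : k = i ∨ k = j :=
  eq_or_eq_of_simple_mem_rankTwoParabolic cs hij (mem_rankTwoParabolic_of_inversionParity cs hu _
    ((isRightDescent_iff_inversionParity cs).1 hk))

lemma existsUnique_isRightDescent_wordProd_alternatingWord (cs : CoxeterSystem M W) {i j : B}
    (hij : i ≠ j) {n : ℕ} (h₀ : n ≠ 0) (hn : M i j = 0 ∨ n < M i j) :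
    ∃! k, cs.IsRightDescent (cs.wordProd (alternatingWord i j n)) k := by
  refine ⟨j, isRightDescent_wordProd_alternatingWord cs hij h₀ (by omega), fun k hk ↦ ?_⟩
  refine (eq_or_eq_of_isRightDescent cs hij (wordProd_alternatingWord_mem cs i j n) hk).resolve_left
    ?_
  rintro rfl
  exact not_isRightDescent_wordProd_alternatingWord cs hij hn hk

lemma bigrassmannian_wordProd_alternatingWord (cs : CoxeterSystem M W) {i j : B}
    (hij : i ≠ j) {n : ℕ} (h₀ : n ≠ 0) (hn : M i j = 0 ∨ n < M i j) :
    Bigrassmannian cs (cs.wordProd (alternatingWord i j n)) := by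
  refine ⟨?_, existsUnique_isRightDescent_wordProd_alternatingWord cs hij h₀ hn⟩
  simp only [← cs.isRightDescent_inv_iff]
  obtain h | h := inv_wordProd_alternatingWord cs i j n <;> rw [h]
  · exact existsUnique_isRightDescent_wordProd_alternatingWord cs hij h₀ hn
  · exact existsUnique_isRightDescent_wordProd_alternatingWord cs hij.symm h₀
      (by rwa [M.symmetric])

lemma eq_w0_of_isRightDescent (cs : CoxeterSystem M W) {i j : B} (hij : i ≠ j) {u : W}
    (hu : u ∈ rankTwoParabolic cs i j) (hi : cs.IsRightDescent u i) (hj : cs.IsRightDescent u j) :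
    M i j ≠ 0 ∧ u = w0 cs i j := by
  obtain ⟨n, hn, h⟩ := exists_alternatingWord_of_mem_rankTwoParabolic cs hij hu
  have hnm : ¬ (M i j = 0 ∨ n < M i j) := by
    intro hlt
    obtain rfl | rfl := h
    · exact not_isRightDescent_wordProd_alternatingWord cs hij hlt hi
    · exact not_isRightDescent_wordProd_alternatingWord cs hij.symm (by rwa [M.symmetric]) hj
  obtain rfl : n = M i j := by omega
  refine ⟨by omega, ?_⟩
  rw [w0_eq_wordProd_alternatingWord]
  obtain h | h := h
  · exact h
  · rw [h, wordProd_alternatingWord_swap]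

lemma setOf_isRightDescent_w0 (cs : CoxeterSystem M W) {i j : B} (hij : i ≠ j) (hm : M i j ≠ 0) :
    {k | cs.IsRightDescent (w0 cs i j) k} = {i, j} := by
  ext k
  rw [Set.mem_ofPred_eq, Set.mem_insert_iff, Set.mem_singleton_iff, w0_eq_wordProd_alternatingWord]
  refine ⟨eq_or_eq_of_isRightDescent cs hij (wordProd_alternatingWord_mem cs i j _), ?_⟩
  rintro (rfl | rfl)
  · rw [wordProd_alternatingWord_swap]
    exact isRightDescent_wordProd_alternatingWord cs hij.symm hm (.inr (M.symmetric _ _).le)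
  · exact isRightDescent_wordProd_alternatingWord cs hij hm (.inr le_rfl)

lemma w0_inv (cs : CoxeterSystem M W) (i j : B) : (w0 cs i j)⁻¹ = w0 cs i j := by
  rw [w0_eq_wordProd_alternatingWord]
  obtain h | h := inv_wordProd_alternatingWord cs i j (M i j)
  · exact h
  · rw [h, wordProd_alternatingWord_swap]

lemma w0_comm (cs : CoxeterSystem M W) (i j : B) : w0 cs i j = w0 cs j i := by
  rw [w0_eq_wordProd_alternatingWord, w0_eq_wordProd_alternatingWord, M.symmetric j i,
    wordProd_alternatingWord_swap]

lemma setOf_isLeftDescent_w0 (cs : CoxeterSystem M W) {i j : B} (hij : i ≠ j) (hm : M i j ≠ 0) :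
    {k | cs.IsLeftDescent (w0 cs i j) k} = {i, j} := by
  simp only [← cs.isRightDescent_inv_iff, w0_inv, setOf_isRightDescent_w0 cs hij hm]

lemma bigrassmannian_w0_mul_simple (cs : CoxeterSystem M W) {i j : B} (hij : i ≠ j)
    (hm : M i j ≠ 0) : Bigrassmannian cs (w0 cs i j * cs.simple j) := by
  have h2 := two_le_of_ne hij hm
  obtain ⟨n, hn⟩ := Nat.exists_eq_succ_of_ne_zero hm
  rw [w0_eq_wordProd_alternatingWord, hn, Nat.succ_eq_add_one, wordProd_alternatingWord_succ,
    cs.simple_mul_simple_cancel_right]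
  exact bigrassmannian_wordProd_alternatingWord cs hij.symm (by omega)
    (by rw [M.symmetric]; omega)

end RankTwo

section MinimalCosetRepresentative

lemma exists_minimal_rankTwoParabolic_factorization (cs : CoxeterSystem M W) (w : W) (i j : B) :
    ∃ v u, w = v * u ∧ u ∈ rankTwoParabolic cs i j ∧
      ∀ r ∈ rankTwoParabolic cs i j, cs.length v ≤ cs.length (v * r) := by
  obtain ⟨u, hu, hmin⟩ := exists_minimalFor_of_wellFoundedLT (· ∈ rankTwoParabolic cs i j)
    (fun u ↦ cs.length (w * u)) ⟨1, one_mem _⟩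
  refine ⟨w * u, u⁻¹, by simp, inv_mem hu, fun r hr ↦ ?_⟩
  by_contra! hlt
  rw [mul_assoc] at hlt
  exact hlt.not_ge (hmin (mul_mem hu hr) hlt.le)

lemma isLeftDescent_mul_of_minimal (cs : CoxeterSystem M W) {i j c : B} {v u : W}
    (hv : ∀ r ∈ rankTwoParabolic cs i j, cs.length v ≤ cs.length (v * r))
    (hu : u ∈ rankTwoParabolic cs i j) (hc : cs.IsLeftDescent v c) :
    cs.IsLeftDescent (v * u) c := by
  have hc' := hc
  rw [← cs.isRightDescent_inv_iff, isRightDescent_iff_inversionParity] at hc' ⊢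
  rw [mul_inv_rev, inversionParity_mul, hc', inv_inv, add_eq_left]
  refine (inversionParity_eq_zero_or_one cs _ _).resolve_right fun h ↦ ?_
  have hmin := hv _ (mem_rankTwoParabolic_of_inversionParity cs (inv_mem hu) _ h)
  rw [← mul_assoc, ← mul_assoc, mul_inv_cancel, one_mul] at hmin
  exact hmin.not_gt hc

end MinimalCosetRepresentative

lemma mem_rankTwoParabolic_of_bigrassmannian (cs : CoxeterSystem M W) {w : W} {a b : B}
    (hab : a ≠ b) (hL : {k : B | cs.IsLeftDescent w k} = {a, b})
    (hR : {k : B | cs.IsRightDescent w k} = {a, b})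
    (ha : Bigrassmannian cs (w * cs.simple a)) (hb : Bigrassmannian cs (w * cs.simple b)) :
    w ∈ rankTwoParabolic cs a b := by
  have hL' : ∀ k, cs.IsLeftDescent w k ↔ k = a ∨ k = b := fun k ↦ Set.ext_iff.1 hL k
  have hR' : ∀ k, cs.IsRightDescent w k ↔ k = a ∨ k = b := fun k ↦ Set.ext_iff.1 hR k
  obtain ⟨v, u, rfl, hu, hv⟩ := exists_minimal_rankTwoParabolic_factorization cs w a b
  by_cases hv1 : v = 1
  · rwa [hv1, one_mul]
  obtain ⟨c, hc⟩ := cs.exists_leftDescent_of_ne_one hv1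
  obtain ⟨d, hd, hdc⟩ : ∃ d, cs.IsLeftDescent (v * u) d ∧ d ≠ c := by
    obtain rfl | rfl := (hL' c).1 (isLeftDescent_mul_of_minimal cs hv hu hc)
    exacts [⟨b, (hL' b).2 (.inr rfl), hab.symm⟩, ⟨a, (hL' a).2 (.inl rfl), hab⟩]
  have key : ∀ k, (k = a ∨ k = b) → cs.simple k ∈ rankTwoParabolic cs a b →
      Bigrassmannian cs (v * u * cs.simple k) → cs.simple d * (v * u) = v * u * cs.simple k := by
    intro k hk hmem hbig
    refine simple_mul_eq_mul_simple cs hd ((hR' k).2 hk) fun hd' ↦ hdc (hbig.1.unique hd' ?_)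
    rw [mul_assoc]
    exact isLeftDescent_mul_of_minimal cs hv (mul_mem hu hmem) hc
  have hea := key a (.inl rfl) (simple_left_mem_rankTwoParabolic cs a b) ha
  have heb := key b (.inr rfl) (simple_right_mem_rankTwoParabolic cs a b) hb
  exact absurd (simple_injective cs (mul_left_cancel (hea.symm.trans heb))) hab

/-- Characterization of the elements `w₀(i, j)`. -/
theorem w0_characterization (cs : CoxeterSystem M W) (w : W) :
    ((∃ i j : B, i ≠ j ∧ M i j ≠ 0 ∧ w = w0 cs i j) ↔
      (∃ a b : B, a ≠ b ∧ {k : B | cs.IsLeftDescent w k} = {a, b} ∧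
        {k : B | cs.IsRightDescent w k} = {a, b} ∧
        Bigrassmannian cs (w * cs.simple a) ∧ Bigrassmannian cs (w * cs.simple b))) ∧
    (∀ a b : B, a ≠ b → {k : B | cs.IsLeftDescent w k} = {a, b} →
      {k : B | cs.IsRightDescent w k} = {a, b} →
      Bigrassmannian cs (w * cs.simple a) → Bigrassmannian cs (w * cs.simple b) →
      M a b ≠ 0 ∧ w = w0 cs a b) := by
  have key : ∀ a b : B, a ≠ b → {k : B | cs.IsLeftDescent w k} = {a, b} →
      {k : B | cs.IsRightDescent w k} = {a, b} →
      Bigrassmannian cs (w * cs.simple a) → Bigrassmannian cs (w * cs.simple b) →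
      M a b ≠ 0 ∧ w = w0 cs a b := fun a b hab hL hR ha hb ↦
    eq_w0_of_isRightDescent cs hab (mem_rankTwoParabolic_of_bigrassmannian cs hab hL hR ha hb)
      (hR.ge (.inl rfl)) (hR.ge (.inr rfl))
  refine ⟨⟨?_, ?_⟩, key⟩
  · rintro ⟨i, j, hij, hm, rfl⟩
    refine ⟨i, j, hij, setOf_isLeftDescent_w0 cs hij hm, setOf_isRightDescent_w0 cs hij hm, ?_,
      bigrassmannian_w0_mul_simple cs hij hm⟩
    rw [w0_comm]
    exact bigrassmannian_w0_mul_simple cs hij.symm (by rwa [M.symmetric])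
  · rintro ⟨a, b, hab, hL, hR, ha, hb⟩
    exact ⟨a, b, hab, key a b hab hL hR ha hb⟩

end NilpotencyIndices
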